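/- Let k, m ≥ 1 and let Δ = (a₁ a₂ ⋯ a_m) be any special block of the Hart–Sharir sequence S_k(m). Then Δ is immediately followed in S_k(m) by the contiguous string a_{m−1} a_{m−2} ⋯ a₁, and S_k(m) contains, after this string, further occurrences of a₂, a₃, …, a_m in this order. In particular, S_k(m) contains the N-shaped subsequence a₁ a₂ ⋯ a_m a_{m−1} ⋯ a₂ a₁ a₂ ⋯ a_m. -/

import Mathlib

/-! ### Sequences with special blocks, encoded as token lists

A sequence with special blocks is encoded as a list of tokens: `Tok.sym a` is an
occurrence of the symbol `a`, and `Tok.op` / `Tok.cl` are the opening and closing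
parentheses delimiting the special blocks. -/

/-- Tokens of a symbol sequence with special blocks. -/
inductive Tok : Type where
  | sym : ℕ → Tok
  | op : Tok
  | cl : Tok
deriving DecidableEq, Repr

/-- Tokens of an endpoint sequence with special blocks: `L a` / `R a` are the
left/right endpoint letters of the symbol `a`, and `op`/`cl` delimit blocks. -/
inductive ETok : Type where
  | L : ℕ → ETok
  | R : ℕ → ETok
  | op : ETok
  | cl : ETok
deriving DecidableEq, Repr

/-- Fresh relabeling of the symbols of the `i`-th local copy. -/
def loc (i a : ℕ) : ℕ := 2 * Nat.pair i a

/-- Relabeling of the global symbols. -/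
def glob (a : ℕ) : ℕ := 2 * a + 1

/-- The underlying sequence of symbols of a token list (parentheses dropped). -/
def symsOf : List Tok → List ℕ
  | [] => []
  | Tok.sym a :: r => a :: symsOf r
  | _ :: r => symsOf r

/-- Read a special block: the symbols up to (and excluding) the next closing
parenthesis, together with the remainder of the list after that parenthesis. -/
def takeBlock : List Tok → List ℕ × List Tok
  | [] => ([], [])
  | Tok.cl :: r => ([], r)
  | Tok.sym a :: r => ((takeBlock r).1.cons a, (takeBlock r).2)
  | Tok.op :: r => takeBlock r

theorem takeBlock_len : ∀ l : List Tok, (takeBlock l).2.length ≤ l.length := by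
  intro l
  induction l with
  | nil => simp [takeBlock]
  | cons t r ih => cases t <;> simp [takeBlock] <;> omega

/-- Auxiliary function for the shuffle `A • B`: traverse the `i`-th fresh copy of
`A` (relabeling its symbols by `loc i`), inserting the next global symbol of the
list `ins` (relabeled by `glob`) at the end of each special block and duplicating
the previously last symbol of that block immediately after the block.  The third
argument remembers the (relabeled) last symbol seen. -/
def copyIns (i : ℕ) : List Tok → List ℕ → Option ℕ → List Tok
  | [], _, _ => []
  | Tok.sym a :: r, ins, _ => Tok.sym (loc i a) :: copyIns i r ins (some (loc i a))
  | Tok.op :: r, ins, p => Tok.op :: copyIns i r ins p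
  | Tok.cl :: r, b :: ins, some q =>
      Tok.sym (glob b) :: Tok.cl :: Tok.sym q :: copyIns i r ins (some q)
  | Tok.cl :: r, ins, p => Tok.cl :: copyIns i r ins p

/-- The modified copy `Aᵢ'` of `A` used in the shuffle `A • B`: the symbols of the
`i`-th special block `blk` of `B` are inserted into the special blocks of the copy,
and another copy of the last symbol of `blk` is appended at the very end. -/
def copyA (i : ℕ) (A : List Tok) (blk : List ℕ) : List Tok :=
  copyIns i A blk none ++ (blk.getLast?.elim [] fun a => [Tok.sym (glob a)])

/-- Auxiliary function for the shuffle: traverse `B` (relabeling its symbols by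
`glob`), replacing its `i`-th special block by the modified `i`-th copy of `A`. -/
def bulletAux (A : List Tok) : ℕ → List Tok → List Tok
  | _, [] => []
  | i, Tok.op :: r => copyA i A (takeBlock r).1 ++ bulletAux A (i + 1) (takeBlock r).2
  | i, Tok.sym a :: r => Tok.sym (glob a) :: bulletAux A i r
  | i, Tok.cl :: r => Tok.cl :: bulletAux A i r
termination_by _ l => l.length
decreasing_by
  · exact Nat.lt_succ_of_le (takeBlock_len r)
  · exact Nat.lt_succ_self _
  · exact Nat.lt_succ_self _

/-- The shuffle `A • B` of two sequences with special blocks. -/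
def bullet (A B : List Tok) : List Tok := bulletAux A 0 B

/-- Split each special block of length 2 into two special blocks of length 1. -/
def split2 : List Tok → List Tok
  | Tok.op :: Tok.sym a :: Tok.sym b :: Tok.cl :: r =>
      Tok.op :: Tok.sym a :: Tok.cl :: Tok.op :: Tok.sym b :: Tok.cl :: split2 r
  | t :: r => t :: split2 r
  | [] => []

/-- The Hart–Sharir sequence `S₁(m) = (1 2 ⋯ m) (m−1) ⋯ 2 1 2 ⋯ m`,
with a single special block `(1 2 ⋯ m)`. -/
def S1 (m : ℕ) : List Tok :=
  Tok.op :: ((List.range' 1 m).map Tok.sym) ++ Tok.cl ::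
    (((List.range' 1 (m - 1)).reverse.map Tok.sym) ++ ((List.range' 2 (m - 1)).map Tok.sym))

/-- The number of special blocks of a token sequence. -/
def numBlocks (S : List Tok) : ℕ := S.count Tok.op

/-- The Hart–Sharir sequences `S_k(m)`, defined by double recursion:
`S₁(m)` is the `N`-shaped sequence above; for `k ≥ 2`, `S_k(1)` is `S_{k−1}(2)` with
each special block of length 2 split into two special blocks of length 1; and for
`k, m ≥ 2`, `S_k(m) = S_k(m−1) • S_{k−1}(N)` where `N` is the number of special
blocks of `S_k(m−1)`.  (The value for `k = 0` or `m = 0` is junk.) -/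
def HS : ℕ → ℕ → List Tok
  | 0, _ => []
  | 1, m => S1 m
  | _ + 2, 0 => []
  | k + 2, 1 => split2 (HS (k + 1) 2)
  | k + 2, m + 2 => bullet (HS (k + 2) (m + 1)) (HS (k + 1) (numBlocks (HS (k + 2) (m + 1))))
termination_by k m => (k, m)



/-- The list of special blocks of a token sequence (each block as its list of symbols). -/
def blocksOf : List Tok → List (List ℕ)
  | [] => []
  | Tok.op :: r => (takeBlock r).1 :: blocksOf (takeBlock r).2
  | _ :: r => blocksOf r
termination_by l => l.length
decreasing_by
  · exact Nat.lt_succ_of_le (takeBlock_len r)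
  · exact Nat.lt_succ_self _

/-- The rank of a symbol: the position (counting from 1) that its first occurrence
occupies within its special block (`0` if the symbol lies in no special block). -/
def rankOf (S : List Tok) (a : ℕ) : ℕ :=
  match (blocksOf S).find? (fun b => decide (a ∈ b)) with
  | some b => b.idxOf a + 1
  | none => 0

/-- Two symbols have their first occurrences in the same special block. -/
def SameBlock (S : List Tok) (a b : ℕ) : Prop :=
  ∃ blk ∈ blocksOf S, a ∈ blk ∧ b ∈ blk

/-- The symbol `a` is left-clamped in the sequence `s`: `s` contains the
subsequence `b a b a`, where `b` is the symbol immediately preceding the first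
occurrence of `a` in `s`. -/
def LeftClamped (s : List ℕ) (a : ℕ) : Prop :=
  ∃ (u v : List ℕ) (b : ℕ), s = u ++ b :: a :: v ∧ a ∉ u ∧ b ≠ a ∧
    [b, a, b, a].Sublist s

/-- The symbol `a` is right-clamped in the sequence `s`: `s` contains the
subsequence `a b a b`, where `b` is the symbol immediately following the last
occurrence of `a` in `s`. -/
def RightClamped (s : List ℕ) (a : ℕ) : Prop :=
  ∃ (u v : List ℕ) (b : ℕ), s = u ++ a :: b :: v ∧ a ∉ v ∧ b ≠ a ∧
    [a, b, a, b].Sublist s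

/-- Auxiliary function for the endpoint sequence: the first argument collects the
symbols already seen.  The first occurrence of each symbol becomes an `L` letter,
its last occurrence becomes an `R` letter, all other occurrences are deleted, and
parentheses are kept. -/
def EAux : List ℕ → List Tok → List ETok
  | _, [] => []
  | seen, Tok.op :: r => ETok.op :: EAux seen r
  | seen, Tok.cl :: r => ETok.cl :: EAux seen r
  | seen, Tok.sym a :: r =>
      if a ∈ seen then
        if a ∈ symsOf r then EAux seen r else ETok.R a :: EAux seen r
      else ETok.L a :: EAux (a :: seen) r

/-- The endpoint sequence `E(S)` of a sequence with special blocks. -/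
def Efun (S : List Tok) : List ETok := EAux [] S

/-- Read a special block of an endpoint sequence: the labels of the `L` letters up
to the next closing parenthesis, and the remainder of the list after it. -/
def takeBlockE : List ETok → List ℕ × List ETok
  | [] => ([], [])
  | ETok.cl :: r => ([], r)
  | ETok.L a :: r => ((takeBlockE r).1.cons a, (takeBlockE r).2)
  | _ :: r => takeBlockE r

theorem takeBlockE_len : ∀ l : List ETok, (takeBlockE l).2.length ≤ l.length := by
  intro l
  induction l with
  | nil => simp [takeBlockE]
  | cons t r ih => cases t <;> simp [takeBlockE] <;> omega

/-- Auxiliary function for the endpoint shuffle `A ∘ B`: traverse the `i`-th fresh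
copy of `A` (relabeling by `loc i`), inserting the next left-endpoint letter of the
list `ins` (relabeled by `glob`) at the end of each special block. -/
def ecopyIns (i : ℕ) : List ETok → List ℕ → List ETok
  | [], _ => []
  | ETok.L a :: r, ins => ETok.L (loc i a) :: ecopyIns i r ins
  | ETok.R a :: r, ins => ETok.R (loc i a) :: ecopyIns i r ins
  | ETok.op :: r, ins => ETok.op :: ecopyIns i r ins
  | ETok.cl :: r, b :: ins => ETok.L (glob b) :: ETok.cl :: ecopyIns i r ins
  | ETok.cl :: r, [] => ETok.cl :: ecopyIns i r []

/-- Auxiliary function for the endpoint shuffle: traverse `B` (relabeling by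
`glob`), replacing its `i`-th special block by the `i`-th modified copy of `A`. -/
def eshufAux (A : List ETok) : ℕ → List ETok → List ETok
  | _, [] => []
  | i, ETok.op :: r => ecopyIns i A (takeBlockE r).1 ++ eshufAux A (i + 1) (takeBlockE r).2
  | i, ETok.L a :: r => ETok.L (glob a) :: eshufAux A i r
  | i, ETok.R a :: r => ETok.R (glob a) :: eshufAux A i r
  | i, ETok.cl :: r => ETok.cl :: eshufAux A i r
termination_by _ l => l.length
decreasing_by
  · exact Nat.lt_succ_of_le (takeBlockE_len r)
  · exact Nat.lt_succ_self _
  · exact Nat.lt_succ_self _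
  · exact Nat.lt_succ_self _

/-- The endpoint shuffle `A ∘ B` of two endpoint sequences with special blocks. -/
def eshuffle (A B : List ETok) : List ETok := eshufAux A 0 B

/-- The token list is a well-formed sequence with special blocks: a concatenation
of symbols and of parenthesized blocks consisting only of symbols. -/
inductive Blocked : List Tok → Prop
  | nil : Blocked []
  | sym (a : ℕ) {l : List Tok} : Blocked l → Blocked (Tok.sym a :: l)
  | blk (b : List ℕ) {l : List Tok} :
      Blocked l → Blocked (Tok.op :: b.map Tok.sym ++ Tok.cl :: l)

/-- The special blocks of `S` contain only first occurrences of symbols, and every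
symbol of `S` makes its first occurrence inside a special block. -/
def FirstOccBlocks (S : List Tok) : Prop :=
  (∀ (u b v : List Tok), S = u ++ Tok.op :: b ++ Tok.cl :: v →
      ∀ a : ℕ, Tok.sym a ∈ b → a ∉ symsOf u ∧ (symsOf b).count a = 1) ∧
  (∀ a ∈ symsOf S, ∃ (u b v : List Tok),
      S = u ++ Tok.op :: b ++ Tok.cl :: v ∧ Tok.sym a ∈ b ∧ a ∉ symsOf u)

/-- `S` is a concatenation of symbols and special blocks of length `m`, each block
`a₁ ⋯ a_m` being followed by `a_{m-1} ⋯ a₁` and later by `a₂ ⋯ a_m` as a subsequence. -/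
inductive NShaped (m : ℕ) : List Tok → Prop
  | nil : NShaped m []
  | sym (a : ℕ) {l : List Tok} : NShaped m l → NShaped m (Tok.sym a :: l)
  | blk (b : List ℕ) (w : List Tok) :
      NShaped m ((b.reverse.drop 1).map Tok.sym ++ w) → b.length = m →
      (b.drop 1).Sublist (symsOf w) →
      NShaped m (Tok.op :: (b.map Tok.sym ++
        Tok.cl :: ((b.reverse.drop 1).map Tok.sym ++ w)))

theorem symsOf_append (l r : List Tok) : symsOf (l ++ r) = symsOf l ++ symsOf r := by
  induction l with
  | nil => rfl
  | cons t l ih => cases t <;> simp [symsOf, ih]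

theorem symsOf_map_sym (b : List ℕ) : symsOf (b.map Tok.sym) = b := by
  induction b with
  | nil => rfl
  | cons a b ih => simp [symsOf, ih]

theorem takeBlock_map_sym_append (b : List ℕ) (l : List Tok) :
    takeBlock (b.map Tok.sym ++ Tok.cl :: l) = (b, l) := by
  induction b with
  | nil => rfl
  | cons a b ih => simp [takeBlock, ih]

theorem NShaped.map_sym_append {m : ℕ} (b : List ℕ) {l : List Tok} (h : NShaped m l) :
    NShaped m (b.map Tok.sym ++ l) := by
  induction b with
  | nil => exact h
  | cons a b ih => exact .sym a ih

/-- An opening parenthesis to the right of a block opening lies beyond that block. -/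
theorem append_op_of_map_sym_cl {b : List ℕ} {l u r : List Tok}
    (h : b.map Tok.sym ++ Tok.cl :: l = u ++ Tok.op :: r) :
    ∃ u', l = u' ++ Tok.op :: r := by
  induction b generalizing u with
  | nil =>
    cases u with
    | nil => simp at h
    | cons t u => exact ⟨u, (List.cons.inj h).2⟩
  | cons a b ih =>
    cases u with
    | nil => simp at h
    | cons t u => exact ih (List.cons.inj h).2

theorem NShaped.exists_of_eq {m : ℕ} {S : List Tok} (hS : NShaped m S) {u : List Tok}
    {blk : List ℕ} {v : List Tok}
    (h : S = u ++ Tok.op :: (blk.map Tok.sym ++ Tok.cl :: v)) :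
    ∃ w : List Tok, v = (blk.reverse.drop 1).map Tok.sym ++ w ∧
      (blk.drop 1).Sublist (symsOf w) := by
  induction hS generalizing u with
  | nil => simp at h
  | sym a _ ih =>
    cases u with
    | nil => simp at h
    | cons t u => exact ih (List.cons.inj h).2
  | blk b w _ _ hsub ih =>
    cases u with
    | nil =>
      have h' := congrArg takeBlock (List.cons.inj h).2
      rw [takeBlock_map_sym_append, takeBlock_map_sym_append] at h'
      obtain ⟨rfl, rfl⟩ := Prod.mk.inj h'
      exact ⟨w, rfl, hsub⟩
    | cons t u =>
      obtain ⟨u', hu'⟩ := append_op_of_map_sym_cl (List.cons.inj h).2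
      exact ih hu'

theorem nShaped_S1 (m : ℕ) : NShaped m (S1 m) := by
  have hrev : (List.range' 1 m).reverse.drop 1 = (List.range' 1 (m - 1)).reverse := by
    cases m with
    | zero => rfl
    | succ m => simp [List.range'_concat]
  have hdrop : (List.range' 1 m).drop 1 = List.range' 2 (m - 1) := by
    cases m with
    | zero => rfl
    | succ m => simp [List.range'_succ]
  have hsyms (b : List ℕ) : NShaped m (b.map Tok.sym) := by
    simpa using NShaped.nil.map_sym_append b
  have h := NShaped.blk (m := m) (List.range' 1 m) ((List.range' 2 (m - 1)).map Tok.sym)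
    ((hsyms _).map_sym_append _) (by simp) (by rw [hdrop, symsOf_map_sym])
  rw [hrev] at h
  simpa only [S1, List.cons_append] using h

theorem NShaped.split2 {S : List Tok} (h : NShaped 2 S) : NShaped 1 (split2 S) := by
  induction h with
  | nil => simpa [_root_.split2] using NShaped.nil
  | sym a _ ih => simpa [_root_.split2] using NShaped.sym a ih
  | blk b w _ hlen _ ih =>
    obtain ⟨x, y, rfl⟩ := List.length_eq_two.mp hlen
    have hy := NShaped.blk (m := 1) [y] _ (by simpa using ih) rfl (by simp)
    have hx := NShaped.blk (m := 1) [x] _ (by simpa using hy) rfl (by simp)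
    simpa [_root_.split2] using hx

theorem map_loc_symsOf_sublist_copyIns (i : ℕ) (A : List Tok) (ins : List ℕ) (p : Option ℕ) :
    ((symsOf A).map (loc i)).Sublist (symsOf (copyIns i A ins p)) := by
  fun_induction copyIns i A ins p <;> simp_all [symsOf]

theorem copyIns_map_sym_append (i : ℕ) (b : List ℕ) (l : List Tok) (ins : List ℕ)
    (p : Option ℕ) :
    copyIns i (b.map Tok.sym ++ l) ins p =
      (b.map (loc i)).map Tok.sym ++
        copyIns i l ins (((b.map (loc i)).getLast?).or p) := by
  induction b generalizing p with
  | nil => simp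
  | cons a b ih =>
    simp only [List.map_cons, List.cons_append, copyIns, ih]
    cases h : (b.map (loc i)).getLast? <;> simp [List.getLast?_cons, h]

theorem NShaped.copyIns_append {m : ℕ} (hm : 1 ≤ m) (i : ℕ) {A : List Tok} (hA : NShaped m A)
    {ins : List ℕ} (p : Option ℕ) {tail : List Tok} (hlen : ins.length = numBlocks A)
    (hmem : ∀ x ∈ ins, glob x ∈ symsOf tail) (htail : NShaped (m + 1) tail) :
    NShaped (m + 1) (copyIns i A ins p ++ tail) := by
  induction hA generalizing ins p with
  | nil => simpa [copyIns] using htail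
  | sym a _ ih =>
    simpa [copyIns] using NShaped.sym _ (ih _ (by simpa [numBlocks] using hlen) hmem)
  | blk b w _ hb hsub ih =>
    have hcount : ∀ c : List ℕ, (c.map Tok.sym).count Tok.op = 0 := fun c =>
      List.count_eq_zero.mpr (by simp)
    obtain ⟨c, z, rfl⟩ : ∃ c z, b = c ++ [z] :=
      ⟨_, _, (List.dropLast_append_getLast (List.ne_nil_of_length_pos (by omega))).symm⟩
    cases ins with
    | nil => simp [numBlocks] at hlen
    | cons x ins =>
      have hrec := ih (ins := ins) (some (loc i z))
        (by simpa [numBlocks, hcount] using hlen)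
        (fun y hy => hmem y (List.mem_cons_of_mem _ hy))
      rw [copyIns_map_sym_append, List.append_assoc] at hrec
      set q := (((c ++ [z]).reverse.drop 1).map (loc i)).getLast?.or (some (loc i z)) with hq
      have hres := NShaped.blk (m := m + 1) ((c ++ [z]).map (loc i) ++ [glob x])
        (copyIns i w ins q ++ tail)
        (by simpa using NShaped.sym (loc i z) (by simpa using hrec))
        (by simpa using hb)
        (by
          rw [List.drop_append_of_le_length (by simp), symsOf_append, ← List.map_drop]
          exact ((hsub.map _).trans (map_loc_symsOf_sublist_copyIns ..)).append
            (List.singleton_sublist.mpr (hmem x List.mem_cons_self)))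
      have heq : copyIns i (Tok.op :: ((c ++ [z]).map Tok.sym ++
            Tok.cl :: (((c ++ [z]).reverse.drop 1).map Tok.sym ++ w))) (x :: ins) p =
          Tok.op :: (((c ++ [z]).map (loc i)).map Tok.sym ++ Tok.sym (glob x) :: Tok.cl ::
            Tok.sym (loc i z) :: ((((c ++ [z]).reverse.drop 1).map (loc i)).map Tok.sym ++
              copyIns i w ins q)) := by
        rw [copyIns, copyIns_map_sym_append]
        simp only [List.map_append, List.map_singleton, List.getLast?_concat, Option.or_some,
          copyIns, copyIns_map_sym_append, hq, Option.some_or]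
      rw [heq]
      simpa using hres

theorem bulletAux_map_sym_append (A : List Tok) (i : ℕ) (b : List ℕ) (l : List Tok) :
    bulletAux A i (b.map Tok.sym ++ l) = (b.map glob).map Tok.sym ++ bulletAux A i l := by
  induction b with
  | nil => rfl
  | cons a b ih => simp [bulletAux, ih]

theorem NShaped.bulletAux {m : ℕ} (hm : 1 ≤ m) {A B : List Tok} (hA : NShaped m A)
    (hB : NShaped (numBlocks A) B) (i : ℕ) : NShaped (m + 1) (bulletAux A i B) := by
  induction hB generalizing i with
  | nil => simpa [_root_.bulletAux] using NShaped.nil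
  | sym a _ ih => simpa [_root_.bulletAux] using NShaped.sym _ (ih i)
  | blk b w _ hb _ ih =>
    rw [_root_.bulletAux, takeBlock_map_sym_append, copyA, List.append_assoc]
    refine hA.copyIns_append hm i none hb ?_ ?_
    · intro x hx
      rw [bulletAux_map_sym_append, symsOf_append, symsOf_append, symsOf_map_sym]
      rcases List.eq_nil_or_concat b with rfl | ⟨c, z, rfl⟩
      · simp at hx
      · simp only [List.concat_eq_append, List.mem_append, List.mem_singleton] at hx
        rcases hx with hx | rfl
        · simp only [List.mem_append]
          exact .inr (.inl (List.mem_map_of_mem (by simpa using hx)))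
        · simp [symsOf]
    · cases b.getLast? with
      | none => exact ih (i + 1)
      | some z => exact NShaped.sym _ (ih (i + 1))

theorem nShaped_HS (k m : ℕ) : NShaped m (HS k m) := by
  fun_induction HS k m with
  | case1 => exact .nil
  | case2 m => exact nShaped_S1 m
  | case3 => exact .nil
  | case4 k ih => exact ih.split2
  | case5 k m ihA ihB => exact ihA.bulletAux (by omega) ihB 0

/-- Lemma `lemma_SB_N`: each special block `Δ = (a₁ a₂ ⋯ a_m)` of the Hart–Sharir
sequence `S_k(m)` (for `k, m ≥ 1`) is immediately followed by the contiguous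
string `a_{m−1} a_{m−2} ⋯ a₁`, and `S_k(m)` contains, after this string, further
occurrences of `a₂, a₃, …, a_m` in this order.  In particular `S_k(m)` contains
the `N`-shaped subsequence `a₁ a₂ ⋯ a_m a_{m−1} ⋯ a₂ a₁ a₂ ⋯ a_m`. -/
theorem lemma_SB_N (k m : ℕ) (hk : 1 ≤ k) (hm : 1 ≤ m)
    (u : List Tok) (blk : List ℕ) (v : List Tok)
    (hdec : HS k m = u ++ (Tok.op :: blk.map Tok.sym) ++ (Tok.cl :: v)) :
    (∃ w : List Tok, v = (blk.reverse.drop 1).map Tok.sym ++ w ∧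
        (blk.drop 1).Sublist (symsOf w)) ∧
    (blk ++ blk.reverse.drop 1 ++ blk.drop 1).Sublist (symsOf (HS k m)) := by
  have hdec' : HS k m = u ++ Tok.op :: (blk.map Tok.sym ++ Tok.cl :: v) := by
    simpa using hdec
  obtain ⟨w, rfl, hw⟩ := (nShaped_HS k m).exists_of_eq hdec'
  refine ⟨⟨w, rfl, hw⟩, ?_⟩
  rw [hdec']
  simp only [symsOf_append, symsOf, symsOf_map_sym, List.append_assoc]
  exact List.sublist_append_of_sublist_right
    ((List.Sublist.refl _).append ((List.Sublist.refl _).append hw))
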